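/- Let X and Y be measurable spaces and let the channel be given by a Markov kernel P_{Y|X} from X to Y. A code with M messages consists of an encoder f : {1,…,M} → X and a measurable decoder g : Y → {1,…,M}, and its average error probability is ε = (1/M) Σ_{m=1}^{M} P_{Y|X=f(m)}[ g(Y) ≠ m ]. Let P_X be the uniform distribution on the codewords {f(1),…,f(M)}, let P_Y be the output distribution induced by P_X through the channel, assume P_{Y|X=x} is absolutely continuous with respect to P_Y for every codeword x, and define the information density i(x;y) = log( (dP_{Y|X=x}/dP_Y)(y) ). Then for every β > 0, the average error probability satisfies ε ≥ P_{(X,Y)}[ i(X;Y) ≤ log β ] − β/M, where (X,Y) is distributed according to P_X followed by the channel. -/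

import Mathlib

open MeasureTheory ProbabilityTheory
open scoped ENNReal NNReal

/-- On the event that the log-likelihood ratio `log (dμ/dν)` is at most `log β`, a finite measure
`μ ≪ ν` is bounded by `β • ν`. -/
theorem measure_log_rnDeriv_le_inter_le {Y : Type*} [MeasurableSpace Y] (μ ν : Measure Y)
    [IsFiniteMeasure μ] [IsFiniteMeasure ν] (hac : μ ≪ ν) {β : ℝ} (hβ : 0 < β)
    {A : Set Y} (hA : MeasurableSet A) :
    μ ({y | Real.log ((∂μ/∂ν) y).toReal ≤ Real.log β} ∩ A) ≤ ENNReal.ofReal β * ν A := by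
  have hS : MeasurableSet ({y | (∂μ/∂ν) y ≤ ENNReal.ofReal β} ∩ A) :=
    (measurableSet_le (Measure.measurable_rnDeriv μ ν) measurable_const).inter hA
  calc μ ({y | Real.log ((∂μ/∂ν) y).toReal ≤ Real.log β} ∩ A)
      ≤ μ ({y | (∂μ/∂ν) y ≤ ENNReal.ofReal β} ∩ A) := by
        apply measure_mono_ae
        filter_upwards [Measure.rnDeriv_pos hac, hac.ae_le (Measure.rnDeriv_lt_top μ ν)]
          with y hpos hlt hy
        refine ⟨?_, hy.2⟩
        have h := (Real.log_le_log_iff (ENNReal.toReal_pos hpos.ne' hlt.ne) hβ).1 hy.1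
        exact (ENNReal.le_ofReal_iff_toReal_le hlt.ne hβ.le).2 h
    _ = ∫⁻ y in {y | (∂μ/∂ν) y ≤ ENNReal.ofReal β} ∩ A, (∂μ/∂ν) y ∂ν :=
        (Measure.setLIntegral_rnDeriv hac _).symm
    _ ≤ ∫⁻ _ in {y | (∂μ/∂ν) y ≤ ENNReal.ofReal β} ∩ A, ENNReal.ofReal β ∂ν :=
        setLIntegral_mono' hS fun y hy => hy.1
    _ = ENNReal.ofReal β * ν ({y | (∂μ/∂ν) y ≤ ENNReal.ofReal β} ∩ A) := by
        rw [setLIntegral_const]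
    _ ≤ ENNReal.ofReal β * ν A := by gcongr; exact Set.inter_subset_right

/-- **Information-spectrum (IS) converse bound.**
For a channel given by a Markov kernel `P` from `X` to `Y`, a code with `M` messages
(encoder `f`, measurable decoder `g`) with average error probability `ε`,
output distribution `PY` induced by the uniform distribution on the codewords, and
information density `i x y = log (dP(·|x)/dPY)(y)`, for every `β > 0`:
`ε ≥ P[(i(X;Y) ≤ log β)] - β / M`. -/
theorem IS_lower_bound {X Y : Type*} [MeasurableSpace X] [MeasurableSpace Y]
    (P : Kernel X Y) [IsMarkovKernel P]
    (M : ℕ) (hM : 0 < M)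
    (f : Fin M → X) (g : Y → Fin M) (hg : Measurable g)
    (ε : ℝ) (hε : ε = (1 / (M : ℝ)) * ∑ m : Fin M, ((P (f m)) {y | g y ≠ m}).toReal)
    (PY : Measure Y) (hPY : PY = ((M : ℝ≥0∞))⁻¹ • ∑ m : Fin M, P (f m))
    (hac : ∀ m : Fin M, P (f m) ≪ PY)
    (i : X → Y → ℝ)
    (hi : ∀ x y, i x y = Real.log (((∂(P x)/∂PY)) y).toReal)
    (β : ℝ) (hβ : 0 < β) :
    ε ≥ (1 / (M : ℝ)) * (∑ m : Fin M,
        ((P (f m)) {y | i (f m) y ≤ Real.log β}).toReal) - β / M := by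
  have hM' : (0 : ℝ) < M := by exact_mod_cast hM
  have hPY_prob : IsProbabilityMeasure PY := by
    refine ⟨?_⟩
    have h0 : (M : ℝ≥0∞) ≠ 0 := by exact_mod_cast hM.ne'
    simp [hPY, Measure.finsetSum_apply, ENNReal.inv_mul_cancel h0 (ENNReal.natCast_ne_top M)]
  have hmeas (m : Fin M) : MeasurableSet {y | g y = m} := hg (measurableSet_singleton m)
  have hsum : ∑ m : Fin M, PY.real {y | g y = m} = 1 := by
    have h := sum_measureReal_preimage_singleton (μ := PY) (f := g) Finset.univ
      (fun m _ => hg (measurableSet_singleton m))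
    simpa [Set.preimage, Set.mem_singleton_iff] using h
  have hcode (m : Fin M) : ((P (f m)) {y | i (f m) y ≤ Real.log β}).toReal
      ≤ ((P (f m)) {y | g y ≠ m}).toReal + β * PY.real {y | g y = m} := by
    have hle := measure_log_rnDeriv_le_inter_le (P (f m)) PY (hac m) hβ (hmeas m)
    have hle' := ENNReal.toReal_mono (by finiteness) hle
    rw [ENNReal.toReal_mul, ENNReal.toReal_ofReal hβ.le] at hle'
    have hsub : {y | i (f m) y ≤ Real.log β} ⊆ {y | g y ≠ m} ∪
        ({y | Real.log ((∂(P (f m))/∂PY) y).toReal ≤ Real.log β} ∩ {y | g y = m}) := by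
      intro y hy
      by_cases hgy : g y = m
      · exact Or.inr ⟨by simpa [hi] using hy, hgy⟩
      · exact Or.inl hgy
    calc ((P (f m)) {y | i (f m) y ≤ Real.log β}).toReal
        ≤ (P (f m)).real ({y | g y ≠ m} ∪
          ({y | Real.log ((∂(P (f m))/∂PY) y).toReal ≤ Real.log β} ∩ {y | g y = m})) :=
          measureReal_mono hsub
      _ ≤ _ := (measureReal_union_le _ _).trans (add_le_add le_rfl hle')
  have htotal := Finset.sum_le_sum fun m (_ : m ∈ Finset.univ) => hcode m
  rw [Finset.sum_add_distrib, ← Finset.mul_sum, hsum, mul_one] at htotal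
  have hdiv := mul_le_mul_of_nonneg_left htotal (one_div_pos.2 hM').le
  rw [mul_add, ← hε, one_div_mul_eq_div (M : ℝ) β] at hdiv
  linarith
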